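/- Let X_1, X_2 beated two length-t walks given by y_1, y_2 that share an edge, and let 0 ≤ s < t be the least time such that y_1(s)=y_2(s) and y_1(s+1)=y_2(s+1) (so the edge from (s,y_1(s)) to (s+1,y_1(s+1)) is common to both walks). Let X'_1, X'_2 be the walks obtained by exchanging X_1 and X_2 at time s, i.e. y'_1 agrees with y_1 on {0,…,s} and with y_2 on {s,…,t}, and y'_2 agrees with y_2 on {0,…,s} and with y_1 on {s,…,t}. Then the product of single-walk vertex weights is preserved: W(X_1)·W(X_2) = W(X'_1)·W(X'_2). -/

import Mathlib

namespace OscSixVertex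

open Finset

attribute [local instance] Classical.propDecidable

variable {R : Type*} [CommRing R]

/-- The integer value of a step: `true` is an up (+1) step, `false` a down (−1) step. -/
def stepVal (b : Bool) : ℤ := if b then 1 else -1

/-- The step taken by the walk with step sequence `σ` between times `s` and `s+1`. -/
def stepAt {t : ℕ} (σ : Fin t → Bool) (s : ℕ) : ℤ :=
  if h : s < t then stepVal (σ ⟨s, h⟩) else 0

/-- The height at time `s` of the length-`t` walk starting at `a` with step sequence `σ`. -/
def height {t : ℕ} (a : ℤ) (σ : Fin t → Bool) (s : ℕ) : ℤ :=
  a + ∑ j ∈ Finset.range s, stepAt σ j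

/-- The local vertex weight at vertex `v`, given incoming step `din` and outgoing step `dout`:
`w3` for (+1,+1), `w4` for (−1,−1), `w5` for a peak (+1,−1), `w6` for a valley (−1,+1). -/
def localW (w3 w4 w5 w6 : ℕ × ℤ → R) (v : ℕ × ℤ) (din dout : ℤ) : R :=
  if din = 1 then (if dout = 1 then w3 v else w5 v)
  else (if dout = 1 then w6 v else w4 v)

/-- The vertex weight `W(X)` of a single walk: product over interior times `1 ≤ s ≤ t−1`. -/
def walkW (w3 w4 w5 w6 : ℕ × ℤ → R) {t : ℕ} (a : ℤ) (σ : Fin t → Bool) : R :=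
  ∏ s ∈ Finset.Ico 1 t,
    localW w3 w4 w5 w6 (s, height a σ s) (stepAt σ (s - 1)) (stepAt σ s)

/-- The single-walk generating function `F_t(a → b)`. -/
def genF (w3 w4 w5 w6 : ℕ × ℤ → R) (t : ℕ) (a b : ℤ) : R :=
  ∑ σ ∈ Finset.univ.filter (fun σ : Fin t → Bool => height a σ t = b),
    walkW w3 w4 w5 w6 a σ

/-- Two walks share an edge. -/
def SharesEdge {t : ℕ} (a₁ : ℤ) (σ₁ : Fin t → Bool) (a₂ : ℤ) (σ₂ : Fin t → Bool) : Prop :=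
  ∃ s, s < t ∧ height a₁ σ₁ s = height a₂ σ₂ s ∧ height a₁ σ₁ (s + 1) = height a₂ σ₂ (s + 1)

/-- The walk has a peak at time `s`: step in +1, step out −1. -/
def PeakAt {t : ℕ} (σ : Fin t → Bool) (s : ℕ) : Prop :=
  stepAt σ (s - 1) = 1 ∧ stepAt σ s = -1

/-- The walk has a valley at time `s`: step in −1, step out +1. -/
def ValleyAt {t : ℕ} (σ : Fin t → Bool) (s : ℕ) : Prop :=
  stepAt σ (s - 1) = -1 ∧ stepAt σ s = 1

/-- A pair of walks is osculating: no shared edge, and at every shared interior vertex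
one walk has a peak and the other a valley. -/
def OscPair {t : ℕ} (a₁ : ℤ) (σ₁ : Fin t → Bool) (a₂ : ℤ) (σ₂ : Fin t → Bool) : Prop :=
  ¬ SharesEdge a₁ σ₁ a₂ σ₂ ∧
  ∀ s, 1 ≤ s → s < t → height a₁ σ₁ s = height a₂ σ₂ s →
    ((PeakAt σ₁ s ∧ ValleyAt σ₂ s) ∨ (ValleyAt σ₁ s ∧ PeakAt σ₂ s))

/-- An `N`-walk is osculating if each pair of its walks is osculating. -/
def OscNWalk {N t : ℕ} (a : Fin N → ℤ) (σ : Fin N → Fin t → Bool) : Prop :=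
  ∀ α β, α ≠ β → OscPair (a α) (σ α) (a β) (σ β)

/-- The vertex weight `𝒲(X)` of an osculating `N`-walk: product over all interior vertices
visited; a vertex shared by two walks contributes `w2`, any other vertex contributes the
single-walk weight of the unique walk through it. -/
def oscW (w2 w3 w4 w5 w6 : ℕ × ℤ → R) {N t : ℕ}
    (a : Fin N → ℤ) (σ : Fin N → Fin t → Bool) : R :=
  ∏ s ∈ Finset.Ico 1 t,
    ∏ h ∈ Finset.image (fun α => height (a α) (σ α) s) Finset.univ,
      if ∃ α β : Fin N, α ≠ β ∧ height (a α) (σ α) s = h ∧ height (a β) (σ β) s = h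
      then w2 (s, h)
      else ∏ α ∈ Finset.univ.filter (fun α : Fin N => height (a α) (σ α) s = h),
        localW w3 w4 w5 w6 (s, h) (stepAt (σ α) (s - 1)) (stepAt (σ α) s)

/-- Interchange the tails of the two step sequences at every time in `S`:
the result follows `σ₁` while the number of switch times passed so far is even,
and `σ₂` when it is odd. -/
def swapSteps {t : ℕ} (σ₁ σ₂ : Fin t → Bool) (S : Finset ℕ) : Fin t → Bool :=
  fun j => if Even ((S.filter (fun s => s ≤ (j : ℕ))).card) then σ₁ j else σ₂ j


theorem stepAt_splice {t : ℕ} (σ τ : Fin t → Bool) (s u : ℕ) :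
    stepAt (fun j : Fin t => if (j : ℕ) < s then σ j else τ j) u =
      if u < s then stepAt σ u else stepAt τ u := by
  unfold stepAt
  split_ifs with hu hus hus <;> simp [hus]

theorem height_succ {t : ℕ} (a : ℤ) (σ : Fin t → Bool) (u : ℕ) :
    height a σ (u + 1) = height a σ u + stepAt σ u := by
  simp only [height, Finset.sum_range_succ, add_assoc]

/-- A spliced walk has the heights of the first walk up to the meeting time and of the second
walk afterwards. -/
theorem height_splice {t : ℕ} {a b : ℤ} {σ τ : Fin t → Bool} {s : ℕ}
    (h : height a σ s = height b τ s) (u : ℕ) :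
    height a (fun j : Fin t => if (j : ℕ) < s then σ j else τ j) u =
      if u ≤ s then height a σ u else height b τ u := by
  induction u with
  | zero => simp [height]
  | succ u ih =>
    rw [height_succ, ih, stepAt_splice, height_succ, height_succ]
    rcases lt_trichotomy u s with hu | rfl | hu
    · simp [hu, hu.le, Nat.succ_le_of_lt hu]
    · simp [h]
    · simp [hu.not_ge, hu.not_gt, show ¬ u + 1 ≤ s by omega]

/-- Splicing along a common edge splices the vertex weights. -/
theorem walkW_splice {R : Type*} [CommRing R] (w3 w4 w5 w6 : ℕ × ℤ → R) {t : ℕ} {a b : ℤ}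
    {σ τ : Fin t → Bool} {s : ℕ} (h : height a σ s = height b τ s)
    (h' : height a σ (s + 1) = height b τ (s + 1)) :
    walkW w3 w4 w5 w6 a (fun j : Fin t => if (j : ℕ) < s then σ j else τ j) =
      ∏ u ∈ Finset.Ico 1 t,
        if u ≤ s then localW w3 w4 w5 w6 (u, height a σ u) (stepAt σ (u - 1)) (stepAt σ u)
        else localW w3 w4 w5 w6 (u, height b τ u) (stepAt τ (u - 1)) (stepAt τ u) := by
  have hstep : stepAt σ s = stepAt τ s := by
    rw [height_succ, height_succ, h] at h'
    exact add_left_cancel h'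
  refine Finset.prod_congr rfl fun u hu => ?_
  have hu1 : 1 ≤ u := (Finset.mem_Ico.mp hu).1
  rw [height_splice h, stepAt_splice, stepAt_splice]
  rcases lt_trichotomy u s with hus | rfl | hus
  · simp [hus, hus.le, show u - 1 < s by omega]
  · simp [hstep, show u - 1 < u by omega]
  · simp [hus.not_ge, hus.not_gt, show ¬ u - 1 < s by omega]

/-- **Exchange at the first shared edge preserves the product weight.**
If `s` is the least time at which the two walks share an edge, and the walks are exchanged
at time `s` (tails swapped), then the product of the single-walk vertex weights is
unchanged. -/
theorem exchange_at_shared_edge {R : Type*} [CommRing R]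
    (t : ℕ) (w3 w4 w5 w6 : ℕ × ℤ → R)
    (a₁ a₂ : ℤ) (σ₁ σ₂ : Fin t → Bool) (s : ℕ) (hst : s < t)
    (hshare : height a₁ σ₁ s = height a₂ σ₂ s ∧
      height a₁ σ₁ (s + 1) = height a₂ σ₂ (s + 1))
    (hleast : ∀ u, u < s → ¬(height a₁ σ₁ u = height a₂ σ₂ u ∧
      height a₁ σ₁ (u + 1) = height a₂ σ₂ (u + 1))) :
    walkW w3 w4 w5 w6 a₁ σ₁ * walkW w3 w4 w5 w6 a₂ σ₂
    = walkW w3 w4 w5 w6 a₁ (fun j => if (j : ℕ) < s then σ₁ j else σ₂ j)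
        * walkW w3 w4 w5 w6 a₂ (fun j => if (j : ℕ) < s then σ₂ j else σ₁ j) := by
  rw [walkW_splice w3 w4 w5 w6 hshare.1 hshare.2,
    walkW_splice w3 w4 w5 w6 hshare.1.symm hshare.2.symm, walkW, walkW,
    ← Finset.prod_mul_distrib, ← Finset.prod_mul_distrib]
  refine Finset.prod_congr rfl fun u _ => ?_
  split_ifs
  · rfl
  · exact mul_comm _ _

end OscSixVertex
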